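/- arXiv:1606.06709 — 3 statements merged into one kernel-verified Lean document; each statement's English description precedes it below -/
import Mathlib

section
/- For all real parameters μ > 0, F_z > 0 and R ∈ (0,1], setting q = (1 − (2/3)·R)⁻¹, the function g(f) = −f + ((2−R)/(3·μ·F_z))·|f|·f − ((1−(2/3)·R)/(3·μ·F_z)²)·f³ is strictly decreasing on the interval [−q·μ·F_z, q·μ·F_z]; consequently the Fiala lateral tire force, as a function of the slip angle, is injective on [−arctan(q·μ·F_z/C), arctan(q·μ·F_z/C)] and admits an inverse there. -/
/-- The cubic `-f + ((1 + b) / 2) k f² - (b / 3) k² f³` has derivative `-(1 - k f) (1 - b k f)`,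
hence is strictly decreasing for `0 ≤ f ≤ 1 / (b k)` when `1 ≤ b`. -/
theorem cubic_lt_of_lt {b k x y : ℝ} (hb : 1 ≤ b) (hk : 0 < k) (hx : 0 ≤ x) (hxy : x < y)
    (hy : b * k * y ≤ 1) :
    -y + (1 + b) / 2 * k * y ^ 2 - b / 3 * k ^ 2 * y ^ 3 <
      -x + (1 + b) / 2 * k * x ^ 2 - b / 3 * k ^ 2 * x ^ 3 := by
  have hs : 0 ≤ k * x := by positivity
  have hst : k * x < k * y := mul_lt_mul_of_pos_left hxy hk
  have hS : b * (k * x) < 1 := by nlinarith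
  have hT : b * (k * y) ≤ 1 := by linarith
  generalize hs' : k * x = s at *
  generalize ht' : k * y = t at *
  have h1 : 0 < ((1 - b * s) ^ 2 + (1 - b * s) * (1 - b * t) + (1 - b * t) ^ 2) / 3 := by
    have := mul_nonneg (sub_nonneg.2 hS.le) (sub_nonneg.2 hT)
    have := pow_pos (sub_pos.2 hS) 2
    positivity
  have h2 : 0 ≤ (s + t) / 2 - b / 3 * (s ^ 2 + s * t + t ^ 2) := by
    have := mul_nonneg hs (sub_nonneg.2 hS.le)
    have ht : 0 ≤ t := hs.trans hst.le
    have := mul_nonneg ht (sub_nonneg.2 hT)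
    have := mul_nonneg hs (sub_nonneg.2 hT)
    have := mul_nonneg ht (sub_nonneg.2 hS.le)
    nlinarith
  have h3 := mul_nonneg (sub_nonneg.2 hb) h2
  have h4 : 0 < 1 - (1 + b) / 2 * (s + t) + b / 3 * (s ^ 2 + s * t + t ^ 2) := by
    linarith
  have h5 := mul_pos (sub_pos.2 hxy) h4
  subst hs' ht'
  linarith

/-- An odd function strictly decreasing on `[0, a]` is strictly decreasing on `[-a, a]`. -/
theorem strictAntiOn_Icc_neg_of_odd {g : ℝ → ℝ} {a : ℝ} (hodd : ∀ x, g (-x) = -g x)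
    (hg : StrictAntiOn g (Set.Icc 0 a)) : StrictAntiOn g (Set.Icc (-a) a) := by
  have hneg : StrictAntiOn g (Set.Icc (-a) 0) := by
    rintro x ⟨hx, hx'⟩ y ⟨hy, hy'⟩ hxy
    have h := hg (a := -y) (b := -x) ⟨by linarith, by linarith⟩ ⟨by linarith, by linarith⟩
      (by linarith)
    rw [hodd, hodd] at h
    linarith
  intro x hx y hy hxy
  have ha : 0 ≤ a := by linarith [hx.1, hx.2]
  rcases le_total 0 x with h0x | hx0
  · exact hg ⟨h0x, hx.2⟩ ⟨h0x.trans hxy.le, hy.2⟩ hxy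
  rcases le_total y 0 with hy0 | h0y
  · exact hneg ⟨hx.1, hx0⟩ ⟨hy.1, hy0⟩ hxy
  have h1 : g y ≤ g 0 := hg.antitoneOn ⟨le_rfl, ha⟩ ⟨h0y, hy.2⟩ h0y
  have h2 : g 0 ≤ g x := hneg.antitoneOn ⟨hx.1, hx0⟩ ⟨by linarith, le_rfl⟩ hx0
  rcases hx0.lt_or_eq with h | h
  · exact h1.trans_lt (hneg ⟨hx.1, hx0⟩ ⟨by linarith, le_rfl⟩ h)
  · subst h
    exact hg ⟨le_rfl, ha⟩ ⟨h0y, hy.2⟩ hxy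

/-- Precomposing with `α ↦ C tan α` turns injectivity on `[-a, a]` into injectivity on
`[-arctan (a / C), arctan (a / C)]`. -/
theorem injOn_comp_mul_tan {g : ℝ → ℝ} {a C : ℝ} (hC : 0 < C)
    (hg : Set.InjOn g (Set.Icc (-a) a)) :
    Set.InjOn (fun α => g (C * Real.tan α))
      (Set.Icc (-Real.arctan (a / C)) (Real.arctan (a / C))) := by
  have hdom : ∀ α ∈ Set.Icc (-Real.arctan (a / C)) (Real.arctan (a / C)),
      α ∈ Set.Ioo (-(Real.pi / 2)) (Real.pi / 2) := fun α hα =>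
    ⟨by linarith [hα.1, Real.arctan_lt_pi_div_two (a / C)],
      hα.2.trans_lt (Real.arctan_lt_pi_div_two _)⟩
  have hmaps : ∀ α ∈ Set.Icc (-Real.arctan (a / C)) (Real.arctan (a / C)),
      C * Real.tan α ∈ Set.Icc (-a) a := by
    intro α hα
    have hd := hdom α hα
    have hlo : Real.arctan (-(a / C)) ≤ Real.arctan (Real.tan α) := by
      rw [Real.arctan_neg, Real.arctan_tan hd.1 hd.2]
      exact hα.1
    have hhi : Real.arctan (Real.tan α) ≤ Real.arctan (a / C) := by
      rw [Real.arctan_tan hd.1 hd.2]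
      exact hα.2
    rw [Real.arctan_strictMono.le_iff_le] at hlo hhi
    rw [← neg_div, div_le_iff₀' hC] at hlo
    rw [le_div_iff₀' hC] at hhi
    exact ⟨hlo, hhi⟩
  intro α hα β hβ h
  exact Real.injOn_tan (hdom α hα) (hdom β hβ)
    (mul_left_cancel₀ hC.ne' (hg (hmaps α hα) (hmaps β hβ) h))


/-- Fiala tire model: the lateral-force function
`g(f) = −f + ((2−R)/(3μF_z))·|f|·f − ((1−(2/3)R)/(3μF_z)²)·f³` is strictly
decreasing on `[−q·μ·F_z, q·μ·F_z]` (with `q = (1 − (2/3)·R)⁻¹`); consequently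
the Fiala lateral force `α ↦ g(C·tan α)` is injective on
`[−arctan(q·μ·F_z/C), arctan(q·μ·F_z/C)]`. -/
theorem fiala_strict_anti_and_injective (C μ Fz R : ℝ)
    (hC : 0 < C) (hμ : 0 < μ) (hFz : 0 < Fz) (hR : R ∈ Set.Ioc (0 : ℝ) 1) :
    StrictAntiOn
      (fun f : ℝ => -f + ((2 - R) / (3 * μ * Fz)) * |f| * f
        - ((1 - (2 / 3) * R) / (3 * μ * Fz) ^ 2) * f ^ 3)
      (Set.Icc (-((1 - (2 / 3) * R)⁻¹ * μ * Fz)) ((1 - (2 / 3) * R)⁻¹ * μ * Fz)) ∧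
    Set.InjOn
      (fun α : ℝ => (fun f : ℝ => -f + ((2 - R) / (3 * μ * Fz)) * |f| * f
        - ((1 - (2 / 3) * R) / (3 * μ * Fz) ^ 2) * f ^ 3) (C * Real.tan α))
      (Set.Icc (-Real.arctan ((1 - (2 / 3) * R)⁻¹ * μ * Fz / C))
        (Real.arctan ((1 - (2 / 3) * R)⁻¹ * μ * Fz / C))) := by
  obtain ⟨-, hR1⟩ := hR
  have hanti : StrictAntiOn
      (fun f : ℝ => -f + ((2 - R) / (3 * μ * Fz)) * |f| * f
        - ((1 - (2 / 3) * R) / (3 * μ * Fz) ^ 2) * f ^ 3)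
      (Set.Icc (-((1 - (2 / 3) * R)⁻¹ * μ * Fz)) ((1 - (2 / 3) * R)⁻¹ * μ * Fz)) := by
    refine strictAntiOn_Icc_neg_of_odd (fun x => ?_) ?_
    · simp only [abs_neg]
      ring
    · rintro x ⟨hx, -⟩ y ⟨hy, hy'⟩ hxy
      have hpos : 0 < 1 - (2 / 3) * R := by linarith
      have hpeak : (3 - 2 * R) * (3 * μ * Fz)⁻¹ * y ≤ 1 := by
        calc (3 - 2 * R) * (3 * μ * Fz)⁻¹ * y
            ≤ (3 - 2 * R) * (3 * μ * Fz)⁻¹ * ((1 - (2 / 3) * R)⁻¹ * μ * Fz) :=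
              mul_le_mul_of_nonneg_left hy'
                (mul_nonneg (by linarith) (by positivity))
          _ = 1 := by
              rw [show 3 - 2 * R = 3 * (1 - (2 / 3) * R) by ring]
              generalize 1 - (2 / 3) * R = c at hpos ⊢
              field_simp
      have h := cubic_lt_of_lt (b := 3 - 2 * R) (k := (3 * μ * Fz)⁻¹) (by linarith)
        (by positivity) hx hxy hpeak
      simp only [abs_of_nonneg hx, abs_of_nonneg hy, div_eq_mul_inv, ← inv_pow]
      linarith
  exact ⟨hanti, injOn_comp_mul_tan hC hanti.injOn⟩
end

section
/- For all real parameters μ > 0, F_z > 0 and R ∈ (0,1], setting q = (1 − (2/3)·R)⁻¹, for every f ∈ [0, 3·μ·F_z] the cubic p(f) = −f + ((2−R)/(3·μ·F_z))·f² − ((1−(2/3)·R)/(3·μ·F_z)²)·f³ satisfies p(q·μ·F_z) ≤ p(f) ≤ 0; i.e., the magnitude of the unsaturated Fiala lateral force is maximized exactly at the peak slip level f = q·μ·F_z. -/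
/-- Fiala tire model: on `[0, 3·μ·F_z]` the unsaturated lateral-force cubic is
nonpositive and is minimized (i.e. the force magnitude is maximized) exactly at
the peak slip level `f = q·μ·F_z`, with `q = (1 − (2/3)·R)⁻¹`. -/
theorem fiala_peak_is_minimum (μ Fz R : ℝ)
    (hμ : 0 < μ) (hFz : 0 < Fz) (hR : R ∈ Set.Ioc (0 : ℝ) 1) :
    ∀ f ∈ Set.Icc (0 : ℝ) (3 * μ * Fz),
      (fun f : ℝ => -f + ((2 - R) / (3 * μ * Fz)) * f ^ 2
          - ((1 - (2 / 3) * R) / (3 * μ * Fz) ^ 2) * f ^ 3)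
        ((1 - (2 / 3) * R)⁻¹ * μ * Fz)
        ≤ (fun f : ℝ => -f + ((2 - R) / (3 * μ * Fz)) * f ^ 2
          - ((1 - (2 / 3) * R) / (3 * μ * Fz) ^ 2) * f ^ 3) f ∧
      (fun f : ℝ => -f + ((2 - R) / (3 * μ * Fz)) * f ^ 2
          - ((1 - (2 / 3) * R) / (3 * μ * Fz) ^ 2) * f ^ 3) f ≤ 0 := by
  intro f ⟨hf0, hf1⟩
  obtain ⟨hR0, hR1⟩ := hR
  have hm : 0 < 3 * μ * Fz := by positivity
  have hc : 0 < 1 - (2 / 3) * R := by linarith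
  obtain ⟨x, rfl⟩ : ∃ x, f = 3 * μ * Fz * x := ⟨f / (3 * μ * Fz), by field_simp⟩
  have hx0 : 0 ≤ x := nonneg_of_mul_nonneg_right hf0 hm
  have hx1 : x ≤ 1 := by
    by_contra! h
    nlinarith
  constructor
  · rw [← sub_nonneg]
    have hd : 0 ≤ 4 / 3 - R - (1 - (2 / 3) * R) * x := by nlinarith
    have key : 0 ≤ 3 * μ * Fz * ((x - (1 - (2 / 3) * R)⁻¹ / 3) ^ 2 *
        (4 / 3 - R - (1 - (2 / 3) * R) * x)) := by positivity
    refine key.trans_eq ?_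
    obtain ⟨c, hcR⟩ : ∃ c, c = 1 - (2 / 3) * R := ⟨_, rfl⟩
    obtain rfl : R = 3 / 2 * (1 - c) := by linarith
    rw [← hcR] at hc ⊢
    field_simp
    ring
  · have key : 0 ≤ 3 * μ * Fz * (x * ((1 - x) ^ 2 + R * x * (1 - 2 / 3 * x))) := by
      have : 0 ≤ 1 - 2 / 3 * x := by linarith
      positivity
    rw [← neg_nonneg]
    refine key.trans_eq ?_
    field_simp
    ring
end

section
/- For all real parameters μ > 0, F_z > 0 and R ∈ (0,1], setting q = (1 − (2/3)·R)⁻¹, the peak lateral force magnitude of the Fiala tire model is at least the full-sliding force magnitude: −p(q·μ·F_z) ≥ μ·R·F_z, where p(f) = −f + ((2−R)/(3·μ·F_z))·f² − ((1−(2/3)·R)/(3·μ·F_z)²)·f³. -/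
/-- Fiala tire model: the peak lateral force magnitude is at least the
full-sliding force magnitude `μ·R·F_z`. -/
theorem fiala_peak_ge_sliding (μ Fz R : ℝ)
    (hμ : 0 < μ) (hFz : 0 < Fz) (hR : R ∈ Set.Ioc (0 : ℝ) 1) :
    μ * R * Fz ≤
      -((fun f : ℝ => -f + ((2 - R) / (3 * μ * Fz)) * f ^ 2
          - ((1 - (2 / 3) * R) / (3 * μ * Fz) ^ 2) * f ^ 3)
        ((1 - (2 / 3) * R)⁻¹ * μ * Fz)) := by
  obtain ⟨-, hR1⟩ := hR
  have hd : 0 < 3 - 2 * R := by linarith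
  have hq : (1 - (2 / 3) * R)⁻¹ = 3 / (3 - 2 * R) := by
    rw [show 1 - (2 / 3) * R = (3 - 2 * R) / 3 by ring, inv_div]
  have hgap : 0 ≤ 4 * (μ * Fz) * (1 - R) ^ 3 / (3 - 2 * R) ^ 2 := by
    have : 0 ≤ 1 - R := sub_nonneg.mpr hR1
    positivity
  rw [← sub_nonneg]
  convert hgap using 1
  rw [hq]
  field_simp
  ring
end
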